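/- Let Σ=(Γ=(V,E),σ) be an unbalanced signed graph with an orientation ω compatible with σ, let G be a finite additive abelian group, and let δ: G^V → G^E be the difference operator (δg)(e) := ω(v,e)·g(v) + ω(u,e)·g(u) for e=uv. Let f be a G-tension of Σ. Then f lies in the image of δ if and only if for every unbalanced cycle X of Σ one has Σ_{e ∈ E(X)} f(e) ∈ 2G; equivalently, f lies in the image of δ if and only if f is a G-potential difference of Σ. -/

import Mathlib

attribute [local instance] Classical.propDecidable

noncomputable section SignedGraphs

/-- A signed graph: a multigraph with ordered pairs of endpoints (the order is
an artefact of the encoding) together with a sign `±1` on each edge. -/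
structure SGraph (V : Type*) (E : Type*) where
  ends : E → V × V
  sign : E → ℤˣ

namespace SGraph

variable {V E : Type*}

/-- Endpoint of `e` on side `b`; a loop has both endpoints equal, but its two
half-edges are distinguished by the side `b`. -/
def endpt (Γ : SGraph V E) (e : E) (b : Bool) : V :=
  cond b (Γ.ends e).1 (Γ.ends e).2

/-- `e` is a loop of the underlying graph. -/
def IsLoop (Γ : SGraph V E) (e : E) : Prop := (Γ.ends e).1 = (Γ.ends e).2

/-- Walks in a signed multigraph: a step traverses an edge `e` in direction `d`
(from the side-`d` endpoint to the other endpoint). -/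
inductive Walk (Γ : SGraph V E) : V → V → Type _
  | nil (v : V) : Walk Γ v v
  | cons (e : E) (d : Bool) {w : V} (p : Walk Γ (Γ.endpt e (!d)) w) : Walk Γ (Γ.endpt e d) w

namespace Walk

variable {Γ : SGraph V E}

/-- The list of vertices visited by a walk (including the final one). -/
def verts : ∀ {u v : V}, Γ.Walk u v → List V
  | _, _, .nil x => [x]
  | _, _, .cons e d p => Γ.endpt e d :: p.verts

/-- The list of edges traversed by a walk. -/
def edges : ∀ {u v : V}, Γ.Walk u v → List E
  | _, _, .nil _ => []
  | _, _, .cons e _ p => e :: p.edges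

/-- The list of (edge, direction) steps of a walk. -/
def steps : ∀ {u v : V}, Γ.Walk u v → List (E × Bool)
  | _, _, .nil _ => []
  | _, _, .cons e d p => (e, d) :: p.steps

/-- The sources of the steps of a walk, i.e. all visited vertices except the last. -/
def srcs {u v : V} (W : Γ.Walk u v) : List V := W.verts.dropLast

/-- The sign of a walk: the product of the signs of its edges. -/
def sgn : ∀ {u v : V}, Γ.Walk u v → ℤˣ
  | _, _, .nil _ => 1
  | _, _, .cons e _ p => Γ.sign e * p.sgn

/-- Concatenation of walks. -/
def append : ∀ {u v w : V}, Γ.Walk u v → Γ.Walk v w → Γ.Walk u w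
  | _, _, _, .nil _, q => q
  | _, _, _, .cons e d p, q => .cons e d (p.append q)

/-- The sum `Σᵢ f(eᵢ)` of the values of `f` on the edges of the walk,
with multiplicity. -/
def edgeSum {G : Type*} [AddCommGroup G] (f : E → G) {u v : V} (W : Γ.Walk u v) : G :=
  (W.edges.map f).sum

/-- The sum `Σᵢ ω(vᵢ,eᵢ)·(Π_{j<i} σ(eⱼ))·f(eᵢ)` along a walk, where `ω(vᵢ,eᵢ)`
is the value of `ω` on the half-edge by which the walk leaves `vᵢ`. -/
def tensionSum {G : Type*} [AddCommGroup G] (ω : E → Bool → ℤˣ) (f : E → G) :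
    ∀ {u v : V}, Γ.Walk u v → G
  | _, _, .nil _ => 0
  | _, _, .cons e d p => ((ω e d : ℤ) • f e) + ((Γ.sign e : ℤ) • tensionSum ω f p)

/-- `Q` is the reverse of the walk `P`. -/
def IsReverseOf {u v : V} (Q : Γ.Walk v u) (P : Γ.Walk u v) : Prop :=
  Q.steps = P.steps.reverse.map fun s => (s.1, !s.2)

end Walk

/-- A closed walk is a cycle if it is nontrivial, visits no vertex twice and
uses no edge twice. -/
def IsCycle (Γ : SGraph V E) {v : V} (W : Γ.Walk v v) : Prop :=
  W.edges ≠ [] ∧ W.srcs.Nodup ∧ W.edges.Nodup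

/-- A balanced (positive) cycle. -/
def IsBalancedCycle (Γ : SGraph V E) {v : V} (W : Γ.Walk v v) : Prop :=
  Γ.IsCycle W ∧ W.sgn = 1

/-- An unbalanced (negative) cycle. -/
def IsUnbalancedCycle (Γ : SGraph V E) {v : V} (W : Γ.Walk v v) : Prop :=
  Γ.IsCycle W ∧ W.sgn = -1

/-- A nontrivial walk that is a simple path (all visited vertices distinct). -/
def IsPathWalk (Γ : SGraph V E) {u v : V} (P : Γ.Walk u v) : Prop :=
  P.edges ≠ [] ∧ P.verts.Nodup

/-- A tight handcuff at `v`: two edge-disjoint unbalanced cycles sharing exactly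
the vertex `v`. -/
def IsTightHandcuff (Γ : SGraph V E) {v : V} (C₁ C₂ : Γ.Walk v v) : Prop :=
  Γ.IsUnbalancedCycle C₁ ∧ Γ.IsUnbalancedCycle C₂ ∧
    (∀ x ∈ C₁.srcs, x ∈ C₂.srcs → x = v) ∧ ∀ e ∈ C₁.edges, e ∉ C₂.edges

/-- A loose handcuff: two vertex-disjoint unbalanced cycles `C₁` (at `u`) and
`C₂` (at `w`) joined by a simple path `P` from `u` to `w` meeting the cycles
exactly in its endpoints. -/
def IsLooseHandcuff (Γ : SGraph V E) {u w : V} (C₁ : Γ.Walk u u) (P : Γ.Walk u w)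
    (C₂ : Γ.Walk w w) : Prop :=
  Γ.IsUnbalancedCycle C₁ ∧ Γ.IsUnbalancedCycle C₂ ∧ Γ.IsPathWalk P ∧
    (∀ x ∈ C₁.srcs, x ∉ C₂.srcs) ∧
    (∀ x ∈ P.verts, x ∈ C₁.srcs → x = u) ∧
    (∀ x ∈ P.verts, x ∈ C₂.srcs → x = w) ∧
    ∀ e ∈ P.edges, e ∉ C₁.edges ∧ e ∉ C₂.edges

/-- The canonical closed walks traversing a circuit of the signed graph:
a balanced cycle, a tight handcuff `C₁ * C₂`, or a loose handcuff
`C₁ * P * C₂ * P⁻¹` (the circuit path edges being used twice). -/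
def IsBasicCircuitWalk (Γ : SGraph V E) {v : V} (W : Γ.Walk v v) : Prop :=
  Γ.IsBalancedCycle W ∨
    (∃ C₁ C₂ : Γ.Walk v v, Γ.IsTightHandcuff C₁ C₂ ∧ W = C₁.append C₂) ∨
    ∃ (w : V) (C₁ : Γ.Walk v v) (P : Γ.Walk v w) (C₂ : Γ.Walk w w) (Q : Γ.Walk w v),
      Γ.IsLooseHandcuff C₁ P C₂ ∧ Q.IsReverseOf P ∧
        W = C₁.append (P.append (C₂.append Q))

/-- A circuit walk: a rotation of a basic circuit walk. -/
def IsCircuitWalk (Γ : SGraph V E) {v : V} (W : Γ.Walk v v) : Prop :=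
  ∃ (u : V) (A : Γ.Walk u v) (B : Γ.Walk v u),
    W = B.append A ∧ Γ.IsBasicCircuitWalk (A.append B)

/-- `e` is a circuit path edge: it lies on the connecting path of an unbalanced
loose handcuff. -/
def IsCircuitPathEdge (Γ : SGraph V E) (e : E) : Prop :=
  ∃ (u w : V) (C₁ : Γ.Walk u u) (P : Γ.Walk u w) (C₂ : Γ.Walk w w),
    Γ.IsLooseHandcuff C₁ P C₂ ∧ e ∈ P.edges

/-- Adjacency via an edge. -/
def Adj (Γ : SGraph V E) (a b : V) : Prop := ∃ e, Γ.ends e = (a, b) ∨ Γ.ends e = (b, a)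

/-- The set of connected components. -/
def Components (Γ : SGraph V E) : Type _ := Quot Γ.Adj

/-- The connected component of a vertex. -/
def comp (Γ : SGraph V E) (v : V) : Γ.Components := Quot.mk _ v

/-- The number `k(Γ)` of connected components. -/
def kAll (Γ : SGraph V E) : ℕ := Nat.card Γ.Components

/-- A connected component is balanced if every cycle it contains is balanced. -/
def IsBalancedComponent (Γ : SGraph V E) (c : Γ.Components) : Prop :=
  ∀ v : V, Γ.comp v = c → ∀ W : Γ.Walk v v, Γ.IsCycle W → W.sgn = 1

/-- The number `k_b(Σ)` of balanced connected components. -/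
def kb (Γ : SGraph V E) : ℕ := Nat.card {c : Γ.Components // Γ.IsBalancedComponent c}

/-- The number `k_u(Σ)` of unbalanced connected components. -/
def ku (Γ : SGraph V E) : ℕ := Nat.card {c : Γ.Components // ¬ Γ.IsBalancedComponent c}

/-- A signed graph is balanced if all its cycles are balanced. -/
def Balanced (Γ : SGraph V E) : Prop :=
  ∀ (v : V) (W : Γ.Walk v v), Γ.IsCycle W → W.sgn = 1

/-- A signed graph is connected if it has exactly one connected component. -/
def Connected (Γ : SGraph V E) : Prop := Γ.kAll = 1

/-- The spanning subgraph `Σ \ Aᶜ` with edge set `A`. -/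
def restrict (Γ : SGraph V E) (A : Set E) : SGraph V A :=
  { ends := fun e => Γ.ends e, sign := fun e => Γ.sign e }

/-- The signed Tutte polynomial (as a function of `x`, `y`, `z`):
`T_Σ(X,Y,Z) = Σ_{A⊆E} (X−1)^{k(Σ\Aᶜ)−k(Σ)} (Y−1)^{|A|−|V|+k_b(Σ\Aᶜ)} (Z−1)^{k_u(Σ\Aᶜ)}`. -/
def signedTutte {K : Type*} [CommRing K] (Γ : SGraph V E) (x y z : K) : K :=
  ∑ᶠ A : Finset E,
    (x - 1) ^ ((Γ.restrict (A : Set E)).kAll - Γ.kAll) *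
      (y - 1) ^ ((A.card + (Γ.restrict (A : Set E)).kb) - Nat.card V) *
        (z - 1) ^ (Γ.restrict (A : Set E)).ku

/-- Deletion of an edge. -/
def deleteEdge (Γ : SGraph V E) (e : E) : SGraph V {e' : E // e' ≠ e} :=
  { ends := fun e' => Γ.ends e'.1, sign := fun e' => Γ.sign e'.1 }

/-- The relation identifying the two endpoints of `e`. -/
def contractRel (Γ : SGraph V E) (e : E) (a b : V) : Prop := (a, b) = Γ.ends e

/-- Contraction of an edge: the two endpoints are identified and the edge is
deleted.  (For a loop this is just deletion, as the identification is trivial.) -/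
def contract (Γ : SGraph V E) (e : E) : SGraph (Quot (Γ.contractRel e)) {e' : E // e' ≠ e} :=
  { ends := fun e' => (Quot.mk _ (Γ.ends e'.1).1, Quot.mk _ (Γ.ends e'.1).2),
    sign := fun e' => Γ.sign e'.1 }

/-- `e` is a bridge: its deletion increases the number of connected components. -/
def IsBridge (Γ : SGraph V E) (e : E) : Prop := Γ.kAll < (Γ.deleteEdge e).kAll

/-- An orientation of the half-edges, compatible with the signature. -/
def IsCompatible (Γ : SGraph V E) (ω : E → Bool → ℤˣ) : Prop :=
  ∀ e, Γ.sign e = -(ω e true * ω e false)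

/-- A `G`-flow: Kirchhoff's law holds at every vertex. -/
def IsFlow (Γ : SGraph V E) (ω : E → Bool → ℤˣ) {G : Type*} [AddCommGroup G]
    (f : E → G) : Prop :=
  ∀ v : V,
    (∑ᶠ e : E, ((if Γ.endpt e true = v then (ω e true : ℤ) • f e else 0) +
      (if Γ.endpt e false = v then (ω e false : ℤ) • f e else 0))) = 0

/-- A `G`-tension: the alternating sum along every circuit walk vanishes. -/
def IsTension (Γ : SGraph V E) (ω : E → Bool → ℤˣ) {G : Type*} [AddCommGroup G]
    (f : E → G) : Prop :=
  ∀ (v : V) (W : Γ.Walk v v), Γ.IsCircuitWalk W → W.tensionSum ω f = 0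

end SGraph

/-- The doubling homomorphism `x ↦ x + x = 2x` of an abelian group. -/
def doubleHom (G : Type*) [AddCommGroup G] : G →+ G :=
  AddMonoidHom.mk' (fun x => x + x) (fun a b => add_add_add_comm a b a b)

/-- The subgroup `2G = {2x : x ∈ G}`. -/
def twoG (G : Type*) [AddCommGroup G] : AddSubgroup G := (doubleHom G).range

/-- The `2`-torsion subgroup `G₂ = {x ∈ G : 2x = 0}`. -/
def torsion2 (G : Type*) [AddCommGroup G] : AddSubgroup G := (doubleHom G).ker

namespace SGraph

variable {V E : Type*}

/-- A `G`-potential difference: a `G`-tension whose sum around every unbalanced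
cycle lies in `2G`. -/
def IsPotentialDifference (Γ : SGraph V E) (ω : E → Bool → ℤˣ) {G : Type*} [AddCommGroup G]
    (f : E → G) : Prop :=
  Γ.IsTension ω f ∧
    ∀ (v : V) (W : Γ.Walk v v), Γ.IsUnbalancedCycle W → W.edgeSum f ∈ twoG G

end SGraph

namespace SGraph

variable {V E : Type*}

/-- Proper coloring by elements of a set `X` with involution `ι`: adjacent
endpoints of a positive edge get different colors, and for a negative edge the
`ι`-image of one endpoint's color differs from the other endpoint's color. -/
def IsProperInvColoring (Γ : SGraph V E) {X : Type*} (ι : X → X) (f : V → X) : Prop :=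
  ∀ e : E, (Γ.sign e = 1 → f ((Γ.ends e).1) ≠ f ((Γ.ends e).2)) ∧
    (Γ.sign e = -1 → ι (f ((Γ.ends e).1)) ≠ f ((Γ.ends e).2))

/-- A proper `G`-coloring: for every edge `e = uv`, `f(u) ≠ f(v)` if `e` is
positive and `-f(u) ≠ f(v)` if `e` is negative, i.e. `σ(e)•f(u) ≠ f(v)`. -/
def IsProperColoring (Γ : SGraph V E) {G : Type*} [AddCommGroup G] (f : V → G) : Prop :=
  ∀ e : E, ((Γ.sign e : ℤ) • f ((Γ.ends e).1)) ≠ f ((Γ.ends e).2)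

/-- Zaslavsky's proper `n`-coloring: colors in `{0, ±1, …, ±n}` with
`f(u) ≠ σ(e)·f(v)` for every edge `e = uv`. -/
def IsProperNColoring (Γ : SGraph V E) (n : ℕ) (f : V → ℤ) : Prop :=
  (∀ v, |f v| ≤ (n : ℤ)) ∧
    ∀ e : E, f ((Γ.ends e).1) ≠ (Γ.sign e : ℤ) * f ((Γ.ends e).2)

/-- `T ⊆ E` is a spanning tree: the spanning subgraph `(V,T)` is connected and
contains no cycle. -/
def IsSpanningTree (Γ : SGraph V E) (T : Set E) : Prop :=
  (Γ.restrict T).Connected ∧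
    ∀ (v : V) (W : (Γ.restrict T).Walk v v), ¬ (Γ.restrict T).IsCycle W

/-- A connected basis of a connected signed graph: a spanning tree if `Σ` is
balanced; otherwise a spanning tree plus one extra edge closing an unbalanced
cycle. -/
def IsConnectedBasis (Γ : SGraph V E) (B : Set E) : Prop :=
  (Γ.Balanced ∧ Γ.IsSpanningTree B) ∨
    (¬ Γ.Balanced ∧ ∃ (T : Set E) (e : E), Γ.IsSpanningTree T ∧ e ∉ T ∧ B = insert e T ∧
      ∀ (v : V) (W : (Γ.restrict B).Walk v v), (Γ.restrict B).IsCycle W → W.sgn = -1)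

/-- Switching at a vertex `v`: the sign of every non-loop edge incident with `v`
is negated; loops keep their sign. -/
def switchAt (Γ : SGraph V E) (v : V) : SGraph V E :=
  { ends := Γ.ends,
    sign := fun e => if ((Γ.ends e).1 = v ↔ (Γ.ends e).2 = v) then Γ.sign e else -Γ.sign e }

/-- Switching at a set `S` of vertices (the composite of the switchings at the
vertices of `S`): the sign of an edge is negated iff exactly one of its
endpoints lies in `S`. -/
def switchSet (Γ : SGraph V E) (S : Set V) : SGraph V E :=
  { ends := Γ.ends,
    sign := fun e => if ((Γ.ends e).1 ∈ S ↔ (Γ.ends e).2 ∈ S) then Γ.sign e else -Γ.sign e }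

/-- Isomorphism of signed graphs (as undirected signed multigraphs). -/
def Iso {V₁ E₁ V₂ E₂ : Type*} (Γ₁ : SGraph V₁ E₁) (Γ₂ : SGraph V₂ E₂) : Prop :=
  ∃ (φ : V₁ ≃ V₂) (ψ : E₁ ≃ E₂), ∀ e : E₁,
    (Γ₂.ends (ψ e) = (φ (Γ₁.ends e).1, φ (Γ₁.ends e).2) ∨
      Γ₂.ends (ψ e) = (φ (Γ₁.ends e).2, φ (Γ₁.ends e).1)) ∧
    Γ₂.sign (ψ e) = Γ₁.sign e

/-- Switching equivalence: isomorphism after switching at a set of vertices. -/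
def SwitchEquiv {V₁ E₁ V₂ E₂ : Type*} (Γ₁ : SGraph V₁ E₁) (Γ₂ : SGraph V₂ E₂) : Prop :=
  ∃ S : Set V₁, Iso (Γ₁.switchSet S) Γ₂

/-- Disjoint union of signed graphs. -/
def disjUnion {V₁ E₁ V₂ E₂ : Type*} (Γ₁ : SGraph V₁ E₁) (Γ₂ : SGraph V₂ E₂) :
    SGraph (V₁ ⊕ V₂) (E₁ ⊕ E₂) where
  ends := fun e => match e with
    | .inl e => (Sum.inl (Γ₁.ends e).1, Sum.inl (Γ₁.ends e).2)
    | .inr e => (Sum.inr (Γ₂.ends e).1, Sum.inr (Γ₂.ends e).2)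
  sign := fun e => match e with
    | .inl e => Γ₁.sign e
    | .inr e => Γ₂.sign e

/-- The difference operator `δ : G^V → G^E`,
`(δg)(e) = ω(v,e)·g(v) + ω(u,e)·g(u)` for `e = uv`. -/
def deltaHom (Γ : SGraph V E) (ω : E → Bool → ℤˣ) (G : Type*) [AddCommGroup G] :
    (V → G) →+ (E → G) :=
  AddMonoidHom.mk'
    (fun g e => (ω e true : ℤ) • g ((Γ.ends e).1) + (ω e false : ℤ) • g ((Γ.ends e).2))
    (by
      intro a b
      funext e
      simp only [Pi.add_apply, smul_add]
      abel)

end SGraph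

end SignedGraphs

namespace SGraph

namespace Walk

variable {V E : Type*} {Γ : SGraph V E} {G : Type*} [AddCommGroup G]

theorem verts_ne_nil {u v : V} (p : Γ.Walk u v) : p.verts ≠ [] := by
  cases p <;> simp [verts]

theorem srcs_nil (v : V) : (Walk.nil v : Γ.Walk v v).srcs = [] := rfl

theorem srcs_cons (e : E) (d : Bool) {w : V} (p : Γ.Walk (Γ.endpt e (!d)) w) :
    (Walk.cons e d p).srcs = Γ.endpt e d :: p.srcs := by
  unfold srcs
  rw [verts, List.dropLast_cons_of_ne_nil p.verts_ne_nil]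

theorem verts_eq {u v : V} (p : Γ.Walk u v) : p.verts = p.srcs ++ [v] := by
  induction p with
  | nil x => rfl
  | cons e d p ih => rw [srcs_cons, verts, ih]; rfl

theorem append_nil' {u v : V} (p : Γ.Walk u v) : p.append (.nil v) = p := by
  induction p with
  | nil x => rfl
  | cons e d p ih => simp [append, ih]

theorem append_assoc' {u v w x : V} (p : Γ.Walk u v) (q : Γ.Walk v w) (r : Γ.Walk w x) :
    (p.append q).append r = p.append (q.append r) := by
  induction p with
  | nil x => rfl
  | cons e d p ih => simp [append, ih]

theorem srcs_append {u v w : V} (p : Γ.Walk u v) (q : Γ.Walk v w) :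
    (p.append q).srcs = p.srcs ++ q.srcs := by
  induction p with
  | nil x => rfl
  | cons e d p ih => simp [append, srcs_cons, ih]

theorem edges_append {u v w : V} (p : Γ.Walk u v) (q : Γ.Walk v w) :
    (p.append q).edges = p.edges ++ q.edges := by
  induction p with
  | nil x => rfl
  | cons e d p ih => simp [append, edges, ih]

theorem sgn_append {u v w : V} (p : Γ.Walk u v) (q : Γ.Walk v w) :
    (p.append q).sgn = p.sgn * q.sgn := by
  induction p with
  | nil x => simp [append, sgn]
  | cons e d p ih => simp [append, sgn, ih, mul_assoc]

theorem steps_append {u v w : V} (p : Γ.Walk u v) (q : Γ.Walk v w) :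
    (p.append q).steps = p.steps ++ q.steps := by
  induction p with
  | nil x => rfl
  | cons e d p ih => simp [append, steps, ih]

theorem tensionSum_append (ω : E → Bool → ℤˣ) (f : E → G) {u v w : V}
    (p : Γ.Walk u v) (q : Γ.Walk v w) :
    (p.append q).tensionSum ω f = p.tensionSum ω f + (p.sgn : ℤ) • q.tensionSum ω f := by
  induction p with
  | nil x => simp [append, sgn, tensionSum]
  | cons e d p ih => simp [append, sgn, tensionSum, ih, mul_smul, add_assoc]

theorem edgeSum_append (f : E → G) {u v w : V} (p : Γ.Walk u v) (q : Γ.Walk v w) :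
    (p.append q).edgeSum f = p.edgeSum f + q.edgeSum f := by
  simp [edgeSum, edges_append]

theorem length_srcs {u v : V} (p : Γ.Walk u v) : p.srcs.length = p.edges.length := by
  induction p with
  | nil x => rfl
  | cons e d p ih => simp [srcs_cons, edges, ih]

theorem head_mem_srcs {u v : V} (p : Γ.Walk u v) (h : p.edges ≠ []) : u ∈ p.srcs := by
  cases p with
  | nil x => exact absurd rfl h
  | cons e d p => simp [srcs_cons]

theorem edges_ne_of_ne {u v : V} (p : Γ.Walk u v) (h : u ≠ v) : p.edges ≠ [] := by
  cases p with
  | nil x => exact absurd rfl h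
  | cons e d p => simp [edges]

theorem head_mem_verts {u v : V} (p : Γ.Walk u v) : u ∈ p.verts := by
  cases p <;> simp [verts]

theorem split_of_mem_verts {u v y : V} (p : Γ.Walk u v) (h : y ∈ p.verts) :
    ∃ (A : Γ.Walk u y) (B : Γ.Walk y v), p = A.append B := by
  induction p with
  | nil x =>
    simp [verts] at h
    subst h
    exact ⟨.nil _, .nil _, rfl⟩
  | cons e d p ih =>
    simp only [verts, List.mem_cons] at h
    rcases h with rfl | h
    · exact ⟨.nil _, .cons e d p, rfl⟩
    · obtain ⟨A, B, rfl⟩ := ih h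
      exact ⟨.cons e d A, B, rfl⟩

theorem mem_verts_of_mem_srcs {u v y : V} (p : Γ.Walk u v) (h : y ∈ p.srcs) : y ∈ p.verts := by
  rw [verts_eq]; simp [h]

theorem split_of_mem_edges {u v : V} (p : Γ.Walk u v) {e : E} (h : e ∈ p.edges) :
    ∃ (d : Bool) (A : Γ.Walk u (Γ.endpt e d)) (C : Γ.Walk (Γ.endpt e (!d)) v),
      p = A.append (.cons e d C) := by
  induction p with
  | nil x => simp [edges] at h
  | cons e' d p ih =>
    simp only [edges, List.mem_cons] at h
    rcases h with rfl | h
    · exact ⟨d, .nil _, p, rfl⟩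
    · obtain ⟨d', A, C, rfl⟩ := ih h
      exact ⟨d', .cons e' d A, C, rfl⟩

theorem endpt_mem_verts {u v : V} (p : Γ.Walk u v) {e : E} (h : e ∈ p.edges) (b : Bool) :
    Γ.endpt e b ∈ p.verts := by
  obtain ⟨d, A, C, rfl⟩ := p.split_of_mem_edges h
  rw [verts_eq, srcs_append, srcs_cons]
  by_cases hb : b = d
  · subst hb; simp
  · have hb' : b = !d := by cases b <;> cases d <;> simp_all
    subst hb'
    have := C.head_mem_verts
    rw [verts_eq] at this
    simp only [List.mem_append] at this ⊢
    simp only [List.mem_cons] at this ⊢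
    tauto

theorem endpt_mem_srcs_closed {v : V} (p : Γ.Walk v v) {e : E} (h : e ∈ p.edges) (b : Bool) :
    Γ.endpt e b ∈ p.srcs := by
  have h1 := p.endpt_mem_verts h b
  rw [verts_eq] at h1
  have h2 := p.head_mem_srcs (by intro h'; simp [h'] at h)
  simp only [List.mem_append, List.mem_singleton] at h1
  rcases h1 with h1 | h1
  · exact h1
  · rw [h1]; exact h2

theorem first_return {u v : V} (W : Γ.Walk u v) :
    W.verts.Nodup ∨ ∃ (x : V) (A : Γ.Walk u x) (X : Γ.Walk x x) (B : Γ.Walk x v),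
      W = A.append (X.append B) ∧ X.edges ≠ [] ∧ (A.append X).srcs.Nodup := by
  induction W with
  | nil x => left; simp [verts]
  | cons e d p ih =>
    rcases ih with ih | ⟨x, A, X, B, rfl, hX, hn⟩
    · by_cases hm : Γ.endpt e d ∈ p.verts
      · right
        obtain ⟨C, D, rfl⟩ := p.split_of_mem_verts hm
        refine ⟨_, .nil _, .cons e d C, D, rfl, by simp [edges], ?_⟩
        rw [verts_eq, srcs_append, List.append_assoc, ← verts_eq] at ih
        have hD := D.head_mem_verts
        rw [List.nodup_append] at ih
        simp only [append, srcs_cons, List.nodup_cons]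
        exact ⟨fun h => ih.2.2 _ h _ hD rfl, ih.1⟩
      · left
        simp only [verts, List.nodup_cons]
        exact ⟨hm, ih⟩
    · right
      by_cases hm : Γ.endpt e d ∈ (A.append X).srcs
      · by_cases hx : Γ.endpt e d = x
        · subst hx
          refine ⟨_, .nil _, .cons e d A, X.append B, rfl, by simp [edges], ?_⟩
          rw [srcs_append, List.nodup_append] at hn
          simp only [append, srcs_cons, List.nodup_cons]
          exact ⟨fun h => hn.2.2 _ h _ (X.head_mem_srcs hX) rfl, hn.1⟩
        · obtain ⟨C, D, hCD⟩ := (A.append X).split_of_mem_verts (mem_verts_of_mem_srcs _ hm)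
          have hD : D.edges ≠ [] := D.edges_ne_of_ne hx
          refine ⟨_, .nil _, .cons e d C, D.append B, ?_, by simp [edges], ?_⟩
          · simp only [append]
            rw [← append_assoc', ← append_assoc', hCD]
          · rw [hCD, srcs_append, List.nodup_append] at hn
            simp only [append, srcs_cons, List.nodup_cons]
            exact ⟨fun h => hn.2.2 _ h _ (D.head_mem_srcs hD) rfl, hn.1⟩
      · refine ⟨x, .cons e d A, X, B, rfl, hX, ?_⟩
        simp only [append, srcs_cons, List.nodup_cons]
        exact ⟨hm, hn⟩

theorem first_return_closed {v : V} (W : Γ.Walk v v) (h : W.edges ≠ []) :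
    ∃ (x : V) (A : Γ.Walk v x) (X : Γ.Walk x x) (B : Γ.Walk x v),
      W = A.append (X.append B) ∧ X.edges ≠ [] ∧ (A.append X).srcs.Nodup := by
  refine W.first_return.resolve_left ?_
  rw [verts_eq, List.nodup_append]
  intro h'
  exact h'.2.2 _ (W.head_mem_srcs h) v (by simp) rfl

theorem edges_nodup_of_path {u v : V} (W : Γ.Walk u v) (h : W.srcs.Nodup) (hv : v ∉ W.srcs) :
    W.edges.Nodup := by
  induction W with
  | nil x => simp [edges]
  | cons e d p ih =>
    rw [srcs_cons, List.nodup_cons] at h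
    rw [srcs_cons, List.mem_cons, not_or] at hv
    simp only [edges, List.nodup_cons]
    refine ⟨fun he => ?_, ih h.2 hv.2⟩
    obtain ⟨d', A, C, rfl⟩ := p.split_of_mem_edges he
    by_cases hd : d' = d
    · subst hd
      apply h.1
      simp [srcs_append, srcs_cons]
    · have hd' : d = !d' := by cases d <;> cases d' <;> simp_all
      subst hd'
      apply h.1
      have := C.head_mem_srcs (C.edges_ne_of_ne (Ne.symm hv.1))
      simp [srcs_append, srcs_cons, this]

theorem compat_any (ω : E → Bool → ℤˣ) (hω : Γ.IsCompatible ω) (e : E) (d : Bool) :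
    Γ.sign e = -(ω e d * ω e (!d)) := by
  cases d
  · rw [hω e, mul_comm]; rfl
  · exact hω e

theorem step_step_back (ω : E → Bool → ℤˣ) (hω : Γ.IsCompatible ω) (f : E → G) (e : E)
    (d : Bool) : ((ω e d : ℤ) • f e) + ((Γ.sign e : ℤ) • ((ω e (!d) : ℤ) • f e)) = 0 := by
  rw [compat_any ω hω e d]
  rcases Int.units_eq_one_or (ω e d) with h | h <;>
    rcases Int.units_eq_one_or (ω e (!d)) with h' | h' <;> simp [h, h']

theorem closed_nodup {u v : V} (W : Γ.Walk u v) (huv : u = v) (h : W.srcs.Nodup)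
    (ω : E → Bool → ℤˣ) (hω : Γ.IsCompatible ω) (f : E → G) :
    W.edges.Nodup ∨ (W.sgn = 1 ∧ W.tensionSum ω f = 0) := by
  cases W with
  | nil x => left; simp [edges]
  | cons e d p =>
    rw [srcs_cons, List.nodup_cons] at h
    have hp : p.edges.Nodup := p.edges_nodup_of_path h.2 (huv ▸ h.1)
    by_cases he : e ∈ p.edges
    · right
      obtain ⟨d', A, C, rfl⟩ := p.split_of_mem_edges he
      by_cases hd : d' = d
      · subst hd
        exfalso
        apply h.1
        simp [srcs_append, srcs_cons]
      · have hd' : d' = !d := by cases d <;> cases d' <;> simp_all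
        subst hd'
        have hA : A.edges = [] := by
          by_contra hA
          have h1 := A.head_mem_srcs hA
          rw [srcs_append, List.nodup_append] at h
          exact h.2.2.2 _ h1 _ (by simp [srcs_cons]) rfl
        have hC : C.edges = [] := by
          by_contra hC
          have h1 : Γ.endpt e d ∈ C.srcs := by
            have h2 := C.head_mem_srcs hC
            have h3 : Γ.endpt e (!!d) = Γ.endpt e d := by rw [Bool.not_not]
            exact h3 ▸ h2
          apply h.1
          simp only [srcs_append, srcs_cons, List.mem_append, List.mem_cons]
          tauto
        have hA' : ∀ {a b : V} (A : Γ.Walk a b), A.edges = [] → A.sgn = 1 ∧ A.tensionSum ω f = 0 := by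
          intro a b A hA
          cases A with
          | nil x => exact ⟨rfl, rfl⟩
          | cons e d p => simp [edges] at hA
        obtain ⟨a1, a2⟩ := hA' A hA
        obtain ⟨c1, c2⟩ := hA' C hC
        constructor
        · simp [sgn, sgn_append, a1, c1]
        · simp only [tensionSum, tensionSum_append, a1, a2, c2]
          simpa using step_step_back ω hω f e d
    · left
      simp only [edges, List.nodup_cons]
      exact ⟨he, hp⟩

theorem exists_reverse (ω : E → Bool → ℤˣ) (hω : Γ.IsCompatible ω) (f : E → G) {u v : V}
    (P : Γ.Walk u v) :
    ∃ Q : Γ.Walk v u, Q.IsReverseOf P ∧ Q.sgn = P.sgn ∧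
      Q.tensionSum ω f = -((P.sgn : ℤ) • P.tensionSum ω f) := by
  induction P with
  | nil x => exact ⟨.nil x, rfl, rfl, by simp [tensionSum]⟩
  | cons e d p ih =>
    obtain ⟨Q, h1, h2, h3⟩ := ih
    have hS : ∃ S : Γ.Walk (Γ.endpt e (!d)) (Γ.endpt e d), S.steps = [(e, !d)] ∧
        S.sgn = Γ.sign e ∧ S.tensionSum ω f = (ω e (!d) : ℤ) • f e := by
      cases d
      · exact ⟨.cons e true (.nil _), rfl, by simp [sgn], by simp [tensionSum]⟩
      · exact ⟨.cons e false (.nil _), rfl, by simp [sgn], by simp [tensionSum]⟩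
    obtain ⟨S, s1, s2, s3⟩ := hS
    refine ⟨Q.append S, ?_, ?_, ?_⟩
    · unfold IsReverseOf at h1 ⊢
      simp [steps_append, steps, h1, s1]
    · simp [sgn_append, sgn, h2, s2, mul_comm]
    · rw [tensionSum_append, h3, s3, h2]
      simp only [sgn, tensionSum]
      rw [compat_any ω hω e d]
      rcases Int.units_eq_one_or (ω e d) with h | h <;>
        rcases Int.units_eq_one_or (ω e (!d)) with h' | h' <;>
        rcases Int.units_eq_one_or p.sgn with h'' | h'' <;> simp [h, h', h'', add_comm]

theorem tensionSum_of_loop (ω : E → Bool → ℤˣ) (f : E → G) {v : V} (W : Γ.Walk v v)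
    (h : W.srcs.Nodup) {e : E} (he : e ∈ W.edges) (h0 : ∀ b, Γ.endpt e b = v) :
    ∃ d, W.tensionSum ω f = (ω e d : ℤ) • f e ∧ W.sgn = Γ.sign e := by
  obtain ⟨d, A, C, rfl⟩ := W.split_of_mem_edges he
  rw [srcs_append, srcs_cons, List.nodup_append, List.nodup_cons] at h
  have hA : A.edges = [] := by
    by_contra hA
    exact h.2.2 _ (A.head_mem_srcs hA) v (by simp [h0]) rfl
  have hC : C.edges = [] := by
    by_contra hC
    apply h.2.1.1
    have h3 : Γ.endpt e d = Γ.endpt e (!d) := by rw [h0, h0]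
    rw [h3]
    exact C.head_mem_srcs hC
  have hA' : ∀ {a b : V} (A : Γ.Walk a b), A.edges = [] → A.sgn = 1 ∧ A.tensionSum ω f = 0 := by
    intro a b A hA
    cases A with
    | nil x => exact ⟨rfl, rfl⟩
    | cons e d p => simp [edges] at hA
  obtain ⟨a1, a2⟩ := hA' A hA
  obtain ⟨c1, c2⟩ := hA' C hC
  exact ⟨d, by simp [tensionSum_append, tensionSum, a1, a2, c2], by simp [sgn_append, sgn, a1, c1]⟩

end Walk

variable {V E : Type*} {Γ : SGraph V E} {G : Type*} [AddCommGroup G]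

open Walk

theorem basic_zero {ω : E → Bool → ℤˣ} {f : E → G} (hf : Γ.IsTension ω f) {v : V}
    (W : Γ.Walk v v) (h : Γ.IsBasicCircuitWalk W) : W.tensionSum ω f = 0 :=
  hf v W ⟨v, W, .nil v, rfl, by rwa [append_nil']⟩

theorem nodup_closed_cases {ω : E → Bool → ℤˣ} (hω : Γ.IsCompatible ω) {f : E → G}
    (hf : Γ.IsTension ω f) {v : V} (W : Γ.Walk v v) (h0 : W.edges ≠ []) (h : W.srcs.Nodup) :
    (W.sgn = 1 ∧ W.tensionSum ω f = 0) ∨ Γ.IsUnbalancedCycle W := by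
  rcases W.closed_nodup rfl h ω hω f with h1 | h1
  · rcases Int.units_eq_one_or W.sgn with hs | hs
    · exact Or.inl ⟨hs, basic_zero hf W (Or.inl ⟨⟨h0, h, h1⟩, hs⟩)⟩
    · exact Or.inr ⟨⟨h0, h, h1⟩, hs⟩
  · exact Or.inl h1

theorem interlaced {ω : E → Bool → ℤˣ} (hω : Γ.IsCompatible ω) {f : E → G} {n : ℕ}
    (ih : ∀ (v : V) (W : Γ.Walk v v), W.edges.length < n → W.sgn = 1 → W.tensionSum ω f = 0)
    {a b : V} (hab : a ≠ b) (A : Γ.Walk a b) (B : Γ.Walk b a) (C : Γ.Walk a b) (D : Γ.Walk b a)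
    (hn : A.edges.length + B.edges.length + C.edges.length + D.edges.length = n)
    (hs : A.sgn * B.sgn * C.sgn * D.sgn = 1) :
    A.tensionSum ω f + (A.sgn : ℤ) • B.tensionSum ω f
      + ((A.sgn * B.sgn : ℤˣ) : ℤ) • C.tensionSum ω f
      + ((A.sgn * B.sgn * C.sgn : ℤˣ) : ℤ) • D.tensionSum ω f = 0 := by
  have lA := List.length_pos_iff.2 (A.edges_ne_of_ne hab)
  have lB := List.length_pos_iff.2 (B.edges_ne_of_ne hab.symm)
  have lC := List.length_pos_iff.2 (C.edges_ne_of_ne hab)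
  have lD := List.length_pos_iff.2 (D.edges_ne_of_ne hab.symm)
  have rl : ∀ {u v : V} (P : Γ.Walk u v), P.edges.length = P.steps.length := by
    intro u v P
    induction P with
    | nil x => rfl
    | cons e d p ih => simp [edges, steps, ih]
  obtain ⟨C', c1, c2, c3⟩ := C.exists_reverse ω hω f
  obtain ⟨D', d1, d2, d3⟩ := D.exists_reverse ω hω f
  have lC' : C'.edges.length = C.edges.length := by
    rw [rl, rl, c1]; simp
  have lD' : D'.edges.length = D.edges.length := by
    rw [rl, rl, d1]; simp
  have h1 := ih _ (A.append B) (by rw [edges_append, List.length_append]; omega)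
  have h2 := ih _ (C.append D) (by rw [edges_append, List.length_append]; omega)
  have h3 := ih _ (B.append C) (by rw [edges_append, List.length_append]; omega)
  have h4 := ih _ (A.append D) (by rw [edges_append, List.length_append]; omega)
  have h5 := ih _ (A.append C') (by rw [edges_append, List.length_append]; omega)
  have h6 := ih _ (B.append D') (by rw [edges_append, List.length_append]; omega)
  simp only [sgn_append, tensionSum_append, c2, c3, d2, d3] at h1 h2 h3 h4 h5 h6
  rcases Int.units_eq_one_or A.sgn with sA | sA <;> rcases Int.units_eq_one_or B.sgn with sB | sB <;>
  rcases Int.units_eq_one_or C.sgn with sC | sC <;> rcases Int.units_eq_one_or D.sgn with sD | sD <;>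
  simp [sA, sB, sC, sD] at h1 h2 h3 h4 h5 h6 hs ⊢ <;>
  grind

theorem tension_positive {ω : E → Bool → ℤˣ} (hω : Γ.IsCompatible ω) {f : E → G}
    (hf : Γ.IsTension ω f) (n : ℕ) :
    ∀ (v : V) (W : Γ.Walk v v), W.edges.length = n → W.sgn = 1 → W.tensionSum ω f = 0 := by
  induction n using Nat.strong_induction_on with
  | _ n ih' =>
  have ih : ∀ (v : V) (W : Γ.Walk v v), W.edges.length < n → W.sgn = 1 →
      W.tensionSum ω f = 0 := fun v W h => ih' _ h v W rfl
  clear ih'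
  suffices key : ∀ (x : V) (X Y : Γ.Walk x x), X.edges ≠ [] → X.srcs.Nodup →
      X.edges.length + Y.edges.length = n → X.sgn * Y.sgn = 1 →
      X.tensionSum ω f + (X.sgn : ℤ) • Y.tensionSum ω f = 0 by
    intro v W hn hs
    by_cases hW : W.edges = []
    · cases W with
      | nil x => rfl
      | cons e d p => simp [edges] at hW
    obtain ⟨x, A, X, B, rfl, hX, hnd⟩ := W.first_return_closed hW
    rw [srcs_append, List.nodup_append] at hnd
    simp only [sgn_append] at hs
    simp only [edges_append, List.length_append] at hn
    have := key x X (B.append A) hX hnd.2.1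
      (by simp only [edges_append, List.length_append]; omega)
      (by rw [sgn_append, ← hs]; ac_rfl)
    simp only [tensionSum_append] at this ⊢
    rcases Int.units_eq_one_or A.sgn with sA | sA <;>
    rcases Int.units_eq_one_or B.sgn with sB | sB <;>
    rcases Int.units_eq_one_or X.sgn with sX | sX <;>
    simp [sA, sB, sX] at this hs ⊢ <;> grind
  intro x X Y hX hXn hn hs
  have lX := List.length_pos_iff.2 hX
  rcases nodup_closed_cases hω hf X hX hXn with ⟨h1, h2⟩ | hXc
  · rw [h1, one_mul] at hs
    rw [h2, ih _ Y (by omega) hs]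
    simp
  have sX : X.sgn = -1 := hXc.2
  have sY : Y.sgn = -1 := by
    rw [sX] at hs
    rcases Int.units_eq_one_or Y.sgn with h | h
    · rw [h] at hs; exact absurd hs (by decide)
    · exact h
  have hY : Y.edges ≠ [] := by
    intro hY
    cases Y with
    | nil x => revert sY; simp only [sgn]; decide
    | cons e d p => simp [edges] at hY
  obtain ⟨z, P, Z, Q, rfl, hZ, hPZ⟩ := Y.first_return_closed hY
  have lZ := List.length_pos_iff.2 hZ
  rw [srcs_append, List.nodup_append] at hPZ
  obtain ⟨hPn, hZn, hPZd⟩ := hPZ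
  simp only [sgn_append] at sY
  simp only [edges_append, List.length_append] at hn
  clear hs hY
  simp only [tensionSum_append, sX]
  rcases nodup_closed_cases hω hf Z hZ hZn with ⟨h1, h2⟩ | hZc
  · have := ih _ (X.append (P.append Q))
      (by simp only [edges_append, List.length_append]; omega)
      (by simp only [sgn_append, sX]; rw [h1, one_mul] at sY; rw [sY]; rfl)
    simpa [tensionSum_append, h1, h2, sX] using this
  have sZ : Z.sgn = -1 := hZc.2
  have sPQ : P.sgn * Q.sgn = 1 := by
    rw [sZ] at sY
    simpa using sY
  have sQ : Q.sgn = P.sgn := by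
    rcases Int.units_eq_one_or P.sgn with h | h <;>
    rcases Int.units_eq_one_or Q.sgn with h' | h' <;> simp [h, h'] at sPQ ⊢
  have tPQ := ih _ (P.append Q) (by simp only [edges_append, List.length_append]; omega)
      (by rw [sgn_append, sPQ])
  rw [tensionSum_append] at tPQ
  by_cases hXP : ∃ y ∈ P.verts, y ∈ X.srcs ∧ y ≠ x
  · obtain ⟨y, hyP, hyX, hy⟩ := hXP
    obtain ⟨X1, X2, rfl⟩ := X.split_of_mem_verts (mem_verts_of_mem_srcs _ hyX)
    obtain ⟨P1, P2, rfl⟩ := P.split_of_mem_verts hyP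
    simp only [edges_append, List.length_append] at hn
    simp only [sgn_append] at sX sPQ
    have := interlaced hω ih hy.symm X1 X2 P1 (P2.append (Z.append Q))
      (by simp only [edges_append, List.length_append]; omega)
      (by simp only [sgn_append, sX, sZ]; simp; rw [← mul_assoc, sPQ])
    simp only [tensionSum_append, sgn_append, sX, sZ] at this ⊢
    rw [← this]
    simp only [smul_add, ← mul_smul, Units.val_mul]
    simp
    abel
  by_cases hXZ : ∃ y ∈ Z.srcs, y ∈ X.srcs ∧ y ≠ x
  · obtain ⟨y, hyZ, hyX, hy⟩ := hXZ
    obtain ⟨X1, X2, rfl⟩ := X.split_of_mem_verts (mem_verts_of_mem_srcs _ hyX)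
    obtain ⟨Z1, Z2, rfl⟩ := Z.split_of_mem_verts (mem_verts_of_mem_srcs _ hyZ)
    simp only [edges_append, List.length_append] at hn
    simp only [sgn_append] at sX sPQ sZ sY
    have := interlaced hω ih hy.symm X1 X2 (P.append Z1) (Z2.append Q)
      (by simp only [edges_append, List.length_append]; omega)
      (by
        simp only [sgn_append, sX]
        have : P.sgn * Z1.sgn * (Z2.sgn * Q.sgn) = -1 := by rw [← sY]; ac_rfl
        rw [mul_assoc, this]; rfl)
    simp only [tensionSum_append, sgn_append, sX, sZ] at this ⊢
    rw [← this]
    simp only [smul_add, ← mul_smul, Units.val_mul]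
    have sZ' : (Z1.sgn : ℤ) * (Z2.sgn : ℤ) = -1 := by
      rw [← Units.val_mul, sZ]; rfl
    simp [mul_assoc, sZ']
    abel
  push Not at hXP hXZ
  by_cases hP : P.edges = []
  · cases P with
    | cons e d p => simp [edges] at hP
    | nil x =>
    have hQ : Q.tensionSum ω f = 0 := by simpa [tensionSum, sgn] using tPQ
    suffices hh : X.tensionSum ω f - Z.tensionSum ω f = 0 by
      simp [tensionSum, sgn, hQ, sub_eq_add_neg] at hh ⊢
      exact hh
    by_cases hE : ∀ e ∈ X.edges, e ∉ Z.edges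
    · have := basic_zero hf (X.append Z) (Or.inr (Or.inl ⟨X, Z,
        ⟨hXc, hZc, fun y h1 h2 => hXZ y h2 h1, hE⟩, rfl⟩))
      simpa [tensionSum_append, sX, sub_eq_add_neg] using this
    · push Not at hE
      obtain ⟨e, heX, heZ⟩ := hE
      have h0 : ∀ b, Γ.endpt e b = x := fun b =>
        hXZ _ (Z.endpt_mem_srcs_closed heZ b) (X.endpt_mem_srcs_closed heX b)
      obtain ⟨d, t1, s1⟩ := X.tensionSum_of_loop ω f hXn heX h0
      obtain ⟨d', t2, s2⟩ := Z.tensionSum_of_loop ω f hZn heZ h0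
      have hc := hω e
      rw [← s1, sX] at hc
      have hc' : ω e true = ω e false := by
        rcases Int.units_eq_one_or (ω e true) with h | h <;>
        rcases Int.units_eq_one_or (ω e false) with h' | h' <;> rw [h, h'] at hc ⊢ <;>
        revert hc <;> decide
      have : ω e d = ω e d' := by cases d <;> cases d' <;> simp [hc']
      rw [t1, t2, this, sub_self]
  · obtain ⟨R, r1, r2, r3⟩ := P.exists_reverse ω hω f
    have hPZ' : ∀ y ∈ P.verts, y ∈ Z.srcs → y = z := by
      intro y h1 h2
      rw [verts_eq, List.mem_append, List.mem_singleton] at h1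
      rcases h1 with h1 | h1
      · exact absurd rfl (hPZd _ h1 _ h2)
      · exact h1
    have hPv : P.verts.Nodup := by
      rw [verts_eq, List.nodup_append]
      refine ⟨hPn, by simp, ?_⟩
      intro a ha b hb
      rw [List.mem_singleton] at hb
      subst hb
      exact hPZd _ ha _ (Z.head_mem_srcs hZ)
    have hxP : x ∈ P.srcs := P.head_mem_srcs hP
    have hloop : ∀ e ∈ P.edges, ¬ ∃ y, ∀ b, Γ.endpt e b = y := by
      rintro e he ⟨y, hy⟩
      obtain ⟨d, A, C, rfl⟩ := P.split_of_mem_edges he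
      rw [verts_eq, srcs_append, List.append_assoc, List.nodup_append, srcs_cons,
        List.cons_append, ← verts_eq, List.nodup_cons] at hPv
      apply hPv.2.1.1
      have h3 : Γ.endpt e d = Γ.endpt e (!d) := by rw [hy, hy]
      rw [h3]
      exact C.head_mem_verts
    have hcirc := basic_zero hf (X.append (P.append (Z.append R)))
      (Or.inr (Or.inr ⟨z, X, P, Z, R, ⟨hXc, hZc, ⟨hP, hPv⟩, ?_, fun y h1 h2 => hXP y h1 h2,
        hPZ', ?_⟩, r1, rfl⟩))
    · simp only [tensionSum_append, sX, sZ, r3] at hcirc ⊢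
      rcases Int.units_eq_one_or P.sgn with h | h <;> simp [h] at hcirc tPQ ⊢ <;> grind
    · intro y h1 h2
      have := hXZ y h2 h1
      subst this
      exact hPZd _ hxP _ h2 rfl
    · intro e he
      exact ⟨fun h => hloop e he ⟨x, fun b => hXP _ (P.endpt_mem_verts he b)
          (X.endpt_mem_srcs_closed h b)⟩,
        fun h => hloop e he ⟨z, fun b => hPZ' _ (P.endpt_mem_verts he b)
          (Z.endpt_mem_srcs_closed h b)⟩⟩

theorem mem_twoG {x : G} : x ∈ twoG G ↔ ∃ y, y + y = x := Iff.rfl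

theorem unit_smul_sub_mem (s : ℤˣ) (x : G) : (s : ℤ) • x - x ∈ twoG G := by
  rcases Int.units_eq_one_or s with h | h
  · simp [h, zero_mem]
  · exact ⟨-x, by simp [h, doubleHom, sub_eq_add_neg]⟩

theorem tension_sub_edgeSum (ω : E → Bool → ℤˣ) (f : E → G) {u v : V} (W : Γ.Walk u v) :
    W.tensionSum ω f - W.edgeSum f ∈ twoG G := by
  induction W with
  | nil x => simp [tensionSum, edgeSum, edges, zero_mem]
  | cons e d p ih =>
    have h1 := unit_smul_sub_mem (ω e d) (f e)
    have h2 := unit_smul_sub_mem (Γ.sign e) (p.tensionSum ω f)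
    have := add_mem (add_mem h1 h2) ih
    convert this using 1
    simp only [tensionSum, edgeSum, edges, List.map_cons, List.sum_cons]
    abel

theorem closed_edgeSum_mem {ω : E → Bool → ℤˣ} (hω : Γ.IsCompatible ω) {f : E → G}
    (hf : Γ.IsTension ω f)
    (h2 : ∀ (v : V) (W : Γ.Walk v v), Γ.IsUnbalancedCycle W → W.edgeSum f ∈ twoG G) (n : ℕ) :
    ∀ (v : V) (W : Γ.Walk v v), W.edges.length = n → W.edgeSum f ∈ twoG G := by
  induction n using Nat.strong_induction_on with
  | _ n ih =>
  intro v W hn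
  by_cases hW : W.edges = []
  · simp [edgeSum, hW, zero_mem]
  obtain ⟨x, A, X, B, rfl, hX, hnd⟩ := W.first_return_closed hW
  rw [srcs_append, List.nodup_append] at hnd
  have lX := List.length_pos_iff.2 hX
  simp only [edges_append, List.length_append] at hn
  have h3 := ih _ (by simp only [edges_append, List.length_append]; omega) v (A.append B) rfl
  have h4 : X.edgeSum f ∈ twoG G := by
    rcases nodup_closed_cases hω hf X hX hnd.2.1 with ⟨_, h⟩ | h
    · have := tension_sub_edgeSum ω f X
      rw [h, zero_sub] at this
      exact neg_mem_iff.1 this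
    · exact h2 _ _ h
  have := add_mem h3 h4
  simp only [edgeSum_append] at this ⊢
  convert this using 1
  abel

theorem tensionSum_delta {ω : E → Bool → ℤˣ} (hω : Γ.IsCompatible ω) (g : V → G) {u v : V}
    (W : Γ.Walk u v) :
    W.tensionSum ω (Γ.deltaHom ω G g) = g u - (W.sgn : ℤ) • g v := by
  induction W with
  | nil x => simp [tensionSum, sgn]
  | cons e d p ih =>
    have hd : Γ.deltaHom ω G g e =
        (ω e d : ℤ) • g (Γ.endpt e d) + (ω e (!d) : ℤ) • g (Γ.endpt e (!d)) := by
      cases d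
      · exact add_comm _ _
      · rfl
    simp only [tensionSum, sgn, ih, hd, compat_any ω hω e d]
    rcases Int.units_eq_one_or (ω e d) with h | h <;>
      rcases Int.units_eq_one_or (ω e (!d)) with h' | h' <;> simp [h, h'] <;> abel

theorem exists_potential {ω : E → Bool → ℤˣ} (hω : Γ.IsCompatible ω) {f : E → G}
    (hf : Γ.IsTension ω f)
    (h2 : ∀ (v : V) (W : Γ.Walk v v), Γ.IsUnbalancedCycle W → W.edgeSum f ∈ twoG G) :
    ∃ g, Γ.deltaHom ω G g = f := by
  have pos : ∀ (v : V) (W : Γ.Walk v v), W.sgn = 1 → W.tensionSum ω f = 0 :=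
    fun v W => tension_positive hω hf _ v W rfl
  have ht : ∀ r : V, ∃ t : G, ∀ W : Γ.Walk r r, W.tensionSum ω f = t - (W.sgn : ℤ) • t := by
    intro r
    by_cases hr : ∃ W : Γ.Walk r r, W.sgn = -1
    · obtain ⟨W0, h0⟩ := hr
      have h3 := add_mem (tension_sub_edgeSum ω f W0) (closed_edgeSum_mem hω hf h2 _ r W0 rfl)
      rw [sub_add_cancel] at h3
      obtain ⟨t, ht⟩ := mem_twoG.1 h3
      refine ⟨t, fun W => ?_⟩
      rcases Int.units_eq_one_or W.sgn with h | h
      · rw [pos r W h, h]; simp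
      · have h4 := pos r (W0.append W) (by rw [sgn_append, h0, h]; rfl)
        rw [tensionSum_append, h0, ← ht] at h4
        rw [h]
        simp at h4 ⊢
        exact (add_neg_eq_zero.1 h4).symm
    · push Not at hr
      refine ⟨0, fun W => ?_⟩
      rw [pos r W ((Int.units_eq_one_or W.sgn).resolve_right (hr W))]
      simp
  choose t ht using ht
  let S : Setoid V :=
    { r := fun u v => Nonempty (Γ.Walk u v)
      iseqv :=
        { refl := fun v => ⟨.nil v⟩
          symm := fun ⟨P⟩ => ⟨(P.exists_reverse ω hω f).choose⟩
          trans := fun ⟨P⟩ ⟨Q⟩ => ⟨P.append Q⟩ } }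
  let root : V → V := fun v => (Quotient.mk S v).out
  have hroot : ∀ v, Nonempty (Γ.Walk v (root v)) := fun v =>
    S.symm (Quotient.exact (Quotient.out_eq (Quotient.mk S v)))
  let P : ∀ v, Γ.Walk v (root v) := fun v => (hroot v).some
  let g : V → G := fun v => (P v).tensionSum ω f + ((P v).sgn : ℤ) • t (root v)
  have hg : ∀ (a r : V) (Q : Γ.Walk a r), r = root a →
      g a = Q.tensionSum ω f + (Q.sgn : ℤ) • t r := by
    intro a r Q hr
    subst hr
    obtain ⟨R, r1, r2, r3⟩ := (P a).exists_reverse ω hω f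
    have h := ht _ (R.append Q)
    rw [tensionSum_append, sgn_append, r2, r3] at h
    simp only [g]
    rcases Int.units_eq_one_or (P a).sgn with h1 | h1 <;>
    rcases Int.units_eq_one_or Q.sgn with h1' | h1' <;> simp [h1, h1'] at h ⊢ <;> grind
  refine ⟨g, ?_⟩
  funext e
  have h1 := hg (Γ.endpt e true) _ (.cons e true (P (Γ.endpt e false))) (by
    have : Quotient.mk S (Γ.endpt e true) = Quotient.mk S (Γ.endpt e false) :=
      Quotient.sound ⟨.cons e true (.nil _)⟩
    simp only [root, this])
  have h3 : g (Γ.endpt e true) = (ω e true : ℤ) • f e + (Γ.sign e : ℤ) • g (Γ.endpt e false) := by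
    rw [h1]
    simp only [tensionSum, sgn, g, smul_add, Units.val_mul, mul_smul, add_assoc]
  change (ω e true : ℤ) • g (Γ.endpt e true) + (ω e false : ℤ) • g (Γ.endpt e false) = f e
  rw [h3, hω e]
  rcases Int.units_eq_one_or (ω e true) with h | h <;>
    rcases Int.units_eq_one_or (ω e false) with h' | h' <;> simp [h, h']

end SGraph

section Statement

open SGraph

/-- Theorem 7.14: a `G`-tension of an unbalanced signed graph is in the image of
the difference operator `δ` iff its edge sum around every unbalanced cycle lies
in `2G`, i.e. iff it is a `G`-potential difference. -/
theorem tension_mem_range_delta_iff (V E : Type) [Finite V] [Finite E]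
    (Γ : SGraph V E) (hunbal : ¬ Γ.Balanced)
    (ω : E → Bool → ℤˣ) (hω : Γ.IsCompatible ω)
    (G : Type) [AddCommGroup G] [Finite G]
    (f : E → G) (hf : Γ.IsTension ω f) :
    (f ∈ Set.range (Γ.deltaHom ω G) ↔
      ∀ (v : V) (W : Γ.Walk v v), Γ.IsUnbalancedCycle W → W.edgeSum f ∈ twoG G) ∧
    (f ∈ Set.range (Γ.deltaHom ω G) ↔ Γ.IsPotentialDifference ω f) := by
  have fwd : f ∈ Set.range (Γ.deltaHom ω G) →
      ∀ (v : V) (W : Γ.Walk v v), Γ.IsUnbalancedCycle W → W.edgeSum f ∈ twoG G := by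
    rintro ⟨g, rfl⟩ v W hW
    have h1 := tension_sub_edgeSum ω (Γ.deltaHom ω G g) W
    have h2 : W.tensionSum ω (Γ.deltaHom ω G g) ∈ twoG G := by
      rw [tensionSum_delta hω, hW.2]
      exact ⟨g v, by simp [doubleHom]⟩
    have := sub_mem h2 h1
    rwa [sub_sub_cancel] at this
  have main : f ∈ Set.range (Γ.deltaHom ω G) ↔
      ∀ (v : V) (W : Γ.Walk v v), Γ.IsUnbalancedCycle W → W.edgeSum f ∈ twoG G :=
    ⟨fwd, fun h => exists_potential hω hf h⟩
  exact ⟨main, main.trans ⟨fun h => ⟨hf, h⟩, fun h => h.2⟩⟩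

end Statement
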